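/- Let p ∈ 𝔻 \ {0}, let λ ∈ ℂ with |λ| = 1 and λp = conj(p), let φ(z) = (az+b)/(cz+d) (a,b,c,d ∈ ℂ, ad−bc ≠ 0) be a linear fractional self-map of 𝔻, let σ(z) = (conj(a)·z − conj(c))/(−conj(b)·z + conj(d)), let β ∈ ℂ \ {0}, and let ψ(z) = β·K_{σ(0)}(z). Then the weighted composition operator W_{ψ,φ} on H² is JW_{ξ_p,τ_p}-normal if and only if (|b|² − |c|²)·p = (−conj(a)·c + conj(b)·d − a·conj(b) + c·conj(d))·|p|² and (|a|² − |d|²)·|p|² = (conj(a)·c − conj(b)·d)·conj(p) − (conj(a)·b − conj(c)·d)·p. -/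

import Mathlib

open scoped ComplexConjugate InnerProductSpace ENNReal NNReal
open Complex Metric

noncomputable section

abbrev H2 : Type := lp (fun _ : ℕ => ℂ) 2

namespace H2

/-- Evaluation of an element of `H²` (given by its sequence of Taylor coefficients)
at a point `z` of the unit disk: `f(z) = ∑ aₙ zⁿ`. -/
def eval (f : H2) (z : ℂ) : ℂ := ∑' n : ℕ, (f : ∀ _ : ℕ, ℂ) n * z ^ n

/-- The Szegő kernel function `K_w(z) = 1/(1 - conj w * z)`. -/
def ker (w z : ℂ) : ℂ := (1 - conj w * z)⁻¹

lemma kernel_memℓp (w : ℂ) (hw : ‖w‖ < 1) :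
    Memℓp (fun n : ℕ => (conj w) ^ n) 2 := by
  apply memℓp_gen
  have hsum : Summable (fun n : ℕ => (‖w‖ ^ 2) ^ n) :=
    summable_geometric_of_lt_one (by positivity) (by nlinarith [norm_nonneg w])
  refine hsum.congr fun n => ?_
  have h2 : ((2 : ℝ≥0∞).toReal) = ((2 : ℕ) : ℝ) := by simp
  rw [h2, Real.rpow_natCast]
  simp [norm_pow, ← pow_mul, Nat.mul_comm]

/-- The reproducing kernel of `H²` at `w` in the unit disk, as an element of `H²`. -/
def kernel (w : ℂ) : H2 :=
  if hw : ‖w‖ < 1 then ⟨fun n : ℕ => (conj w) ^ n, kernel_memℓp w hw⟩ else 0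

/-- `T` is the composition operator `C_φ` on `H²`. -/
def IsCompOp (φ : ℂ → ℂ) (T : H2 →L[ℂ] H2) : Prop :=
  ∀ f : H2, ∀ z : ℂ, ‖z‖ < 1 → eval (T f) z = eval f (φ z)

/-- `W` is the weighted composition operator `W_{ψ,φ}` on `H²`. -/
def IsWCompOp (ψ φ : ℂ → ℂ) (W : H2 →L[ℂ] H2) : Prop :=
  ∀ f : H2, ∀ z : ℂ, ‖z‖ < 1 → eval (W f) z = ψ z * eval f (φ z)

/-- A conjugation on `H²`: a conjugate-linear involution satisfying `⟪Cx, Cy⟫ = ⟪y, x⟫`. -/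
structure IsConjugation (C : H2 → H2) : Prop where
  map_add : ∀ x y : H2, C (x + y) = C x + C y
  map_smul : ∀ (c : ℂ) (x : H2), C (c • x) = conj c • C x
  invol : ∀ x : H2, C (C x) = x
  inner_conj : ∀ x y : H2, ⟪C x, C y⟫_ℂ = ⟪y, x⟫_ℂ

/-- `T` is `C`-normal: `C T* T C = T T*`. -/
def CNormal (C : H2 → H2) (T : H2 →L[ℂ] H2) : Prop :=
  ∀ x : H2, C ((ContinuousLinearMap.adjoint T) (T (C x)))
      = T ((ContinuousLinearMap.adjoint T) x)

/-- `T` is a normal operator: `T* T = T T*`. -/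
def IsNormalOp (T : H2 →L[ℂ] H2) : Prop :=
  (ContinuousLinearMap.adjoint T).comp T = T.comp (ContinuousLinearMap.adjoint T)

/-- `T` is a unitary operator. -/
def IsUnitaryOp (T : H2 →L[ℂ] H2) : Prop :=
  T.comp (ContinuousLinearMap.adjoint T) = ContinuousLinearMap.id ℂ H2 ∧
  (ContinuousLinearMap.adjoint T).comp T = ContinuousLinearMap.id ℂ H2

/-- `C` is the conjugation `J_μ` on `H²`: `(J_μ f)(z) = conj (f (μ * conj z))`. -/
def IsJmu (μ : ℂ) (C : H2 → H2) : Prop :=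
  ∀ f : H2, ∀ z : ℂ, ‖z‖ < 1 → eval (C f) z = conj (eval f (μ * conj z))

/-- `ξ_p(z) = √(1-|p|²) / (1 - conj p * z)`. -/
def xi (p z : ℂ) : ℂ := (Real.sqrt (1 - ‖p‖ ^ 2) : ℂ) / (1 - conj p * z)

/-- `τ_p(z) = λ (p - z) / (1 - conj p * z)`. -/
def tau (p lam z : ℂ) : ℂ := lam * (p - z) / (1 - conj p * z)

/-- `C` is the conjugation `J W_{ξ_p, τ_p}` on `H²`:
`(C f)(z) = conj (ξ_p(conj z) * f (τ_p (conj z)))`. -/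
def IsJW (p lam : ℂ) (C : H2 → H2) : Prop :=
  ∀ f : H2, ∀ z : ℂ, ‖z‖ < 1 →
    eval (C f) z = conj (xi p (conj z) * eval f (tau p lam (conj z)))

end H2

namespace H2

lemma ext_of_eval {f g : H2} (h : ∀ z : ℂ, ‖z‖ < 1 → eval f z = eval g z) : f = g := by
  have analytic : ∀ f : H2, HasFPowerSeriesAt (eval f)
      (FormalMultilinearSeries.ofScalars ℂ (f : ∀ _ : ℕ, ℂ)) 0 := by
    intro f
    have hr : ((1 : ℝ≥0) : ℝ≥0∞) ≤
        (FormalMultilinearSeries.ofScalars ℂ (f : ∀ _ : ℕ, ℂ)).radius := by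
      refine FormalMultilinearSeries.le_radius_of_bound _ ‖f‖ fun n => ?_
      rw [FormalMultilinearSeries.ofScalars_norm]
      simpa using lp.norm_apply_le_norm (by norm_num) f n
    have hpos : 0 < (FormalMultilinearSeries.ofScalars ℂ (f : ∀ _ : ℕ, ℂ)).radius :=
      lt_of_lt_of_le (by norm_num) hr
    have hsum : (FormalMultilinearSeries.ofScalars ℂ (f : ∀ _ : ℕ, ℂ)).sum = eval f := by
      funext z
      exact FormalMultilinearSeries.ofScalars_sum_eq (f : ∀ _ : ℕ, ℂ) z
    exact ⟨_, hsum ▸ FormalMultilinearSeries.hasFPowerSeriesOnBall _ hpos⟩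
  have hev : eval f =ᶠ[nhds 0] eval g := by
    filter_upwards [Metric.ball_mem_nhds (0 : ℂ) one_pos] with z hz
    exact h z (by simpa using hz)
  have hser := ((analytic f).congr hev).eq_formalMultilinearSeries (analytic g)
  exact Subtype.ext ((FormalMultilinearSeries.ofScalars_series_injective ℂ ℂ) hser)

lemma eval_eq_inner (f : H2) {w : ℂ} (hw : ‖w‖ < 1) : eval f w = ⟪kernel w, f⟫_ℂ := by
  rw [lp.inner_eq_tsum, kernel, dif_pos hw]
  simp [eval]

lemma eval_kernel {w z : ℂ} (hw : ‖w‖ < 1) (hz : ‖z‖ < 1) :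
    eval (kernel w) z = (1 - conj w * z)⁻¹ := by
  rw [kernel, dif_pos hw, ← tsum_geometric_of_norm_lt_one]
  · simp [eval, mul_pow]
  · rw [norm_mul, RCLike.norm_conj]
    nlinarith [norm_nonneg w, norm_nonneg z]

lemma eval_smul (k : ℂ) (f : H2) {z : ℂ} (hz : ‖z‖ < 1) : eval (k • f) z = k * eval f z := by
  rw [eval_eq_inner _ hz, eval_eq_inner _ hz, inner_smul_right]

lemma IsWCompOp.adjoint_kernel {ψ φ : ℂ → ℂ} {W : H2 →L[ℂ] H2} (hW : IsWCompOp ψ φ W) {w : ℂ}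
    (hw : ‖w‖ < 1) (hφ : ‖φ w‖ < 1) :
    ContinuousLinearMap.adjoint W (kernel w) = conj (ψ w) • kernel (φ w) := by
  refine ext_inner_right ℂ fun f => ?_
  rw [ContinuousLinearMap.adjoint_inner_left, inner_smul_left, ← eval_eq_inner _ hw,
    ← eval_eq_inner _ hφ, hW f w hw, conj_conj]

/-- `C`-normality amounts to an equality of two Gram kernels on reproducing kernels. -/
lemma cNormal_iff_inner {C : H2 → H2} (hC : IsConjugation C) (W : H2 →L[ℂ] H2) :
    CNormal C W ↔ ∀ w z : ℂ, ‖w‖ < 1 → ‖z‖ < 1 →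
      ⟪W (C (kernel w)), W (C (kernel z))⟫_ℂ =
        eval (W (ContinuousLinearMap.adjoint W (kernel w))) z := by
  have swap : ∀ x y : H2, ⟪C x, y⟫_ℂ = ⟪C y, x⟫_ℂ := fun x y => by
    rw [← hC.inner_conj, hC.invol]
  have swap' : ∀ x y : H2, ⟪x, C y⟫_ℂ = ⟪y, C x⟫_ℂ := fun x y => by
    rw [← hC.inner_conj, hC.invol]
  have key : ∀ w z : ℂ, ‖z‖ < 1 →
      eval (C (ContinuousLinearMap.adjoint W (W (C (kernel w))))) z =
        ⟪W (C (kernel w)), W (C (kernel z))⟫_ℂ := fun w z hz => by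
    rw [eval_eq_inner _ hz, swap', ContinuousLinearMap.adjoint_inner_left]
  constructor
  · intro h w z _ hz
    rw [← key w z hz, h]
  · intro h x
    refine ext_of_eval fun z hz => ?_
    have hk : C (ContinuousLinearMap.adjoint W (W (C (kernel z)))) =
        W (ContinuousLinearMap.adjoint W (kernel z)) :=
      ext_of_eval fun y hy => by rw [key z y hy, h z y hz hy]
    rw [eval_eq_inner _ hz, eval_eq_inner _ hz, swap', ContinuousLinearMap.adjoint_inner_left,
      ← ContinuousLinearMap.adjoint_inner_right W, swap, hk,
      ← ContinuousLinearMap.adjoint_inner_right W, ContinuousLinearMap.adjoint_inner_left]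

/-- The map `τ_p` (after conjugating its argument) sends the disk into itself. -/
lemma norm_sub_mul_conj_lt {p lam w : ℂ} (hp : ‖p‖ < 1) (hlam : ‖lam‖ = 1)
    (hlp : lam * p = conj p) (hw : ‖w‖ < 1) : ‖p - w * conj lam‖ < ‖1 - w * p‖ := by
  have hlp' : conj lam * conj p = p := by simpa using congrArg conj hlp
  have hll : lam * conj lam = 1 := by rw [Complex.mul_conj', hlam]; norm_num
  have h : ((‖1 - w * p‖ ^ 2 - ‖p - w * conj lam‖ ^ 2 : ℝ) : ℂ) =
      ((1 - ‖w‖ ^ 2) * (1 - ‖p‖ ^ 2) : ℝ) := by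
    push_cast
    simp only [← Complex.mul_conj', map_sub, map_mul, map_one, conj_conj]
    linear_combination conj w * hlp + w * hlp' - w * conj w * hll
  have h' := Complex.ofReal_injective h
  have : 0 < (1 - ‖w‖ ^ 2) * (1 - ‖p‖ ^ 2) :=
    mul_pos (by nlinarith [norm_nonneg w]) (by nlinarith [norm_nonneg p])
  exact lt_of_pow_lt_pow_left₀ 2 (norm_nonneg _) (by linarith)

/-- The Krein adjoint of a linear fractional self-map of the disk is again a self-map. -/
lemma norm_krein_lt {a b c d u : ℂ} (hdet : a * d - b * c ≠ 0)
    (hself : ∀ z : ℂ, ‖z‖ < 1 → ‖a * z + b‖ ≤ ‖c * z + d‖) (hu : ‖u‖ < 1) :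
    ‖u * a - c‖ < ‖d - u * b‖ := by
  have hclosed : ∀ z : ℂ, ‖z‖ ≤ 1 → ‖a * z + b‖ ≤ ‖c * z + d‖ := by
    intro z hz
    have hmem : z ∈ closure (Metric.ball (0 : ℂ) 1) := by
      rw [closure_ball _ one_ne_zero]
      simpa using hz
    exact closure_minimal (t := {z : ℂ | ‖a * z + b‖ ≤ ‖c * z + d‖})
      (fun x hx => hself x (by simpa using hx))
      (isClosed_le (by fun_prop) (by fun_prop)) hmem
  have hne : ∀ z : ℂ, ‖z‖ ≤ 1 → d - u * b ≠ z * (u * a - c) := by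
    intro z hz h
    have h1 : c * z + d = u * (a * z + b) := by linear_combination h
    have h2 := hclosed z hz
    have h3 : ‖c * z + d‖ = ‖u‖ * ‖a * z + b‖ := by rw [h1, norm_mul]
    have h4 : a * z + b = 0 := by
      rw [← norm_eq_zero]
      nlinarith [norm_nonneg (a * z + b)]
    have h5 : c * z + d = 0 := by rw [h1, h4, mul_zero]
    exact hdet (by linear_combination a * h5 - c * h4)
  by_contra! hle
  have hE : u * a - c ≠ 0 := by
    intro h0
    rw [h0, norm_zero] at hle
    exact hne 0 (by simp) (by rw [zero_mul]; exact norm_le_zero_iff.mp hle)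
  refine hne ((d - u * b) / (u * a - c)) ?_ (by rw [div_mul_cancel₀ _ hE])
  rw [norm_div]
  exact div_le_one_of_le₀ hle (norm_nonneg _)

lemma IsJW.apply_kernel {p lam : ℂ} {C : H2 → H2} (hCJ : IsJW p lam C)
    (hp : ‖p‖ < 1) (hlam : ‖lam‖ = 1) (hlp : lam * p = conj p) {w : ℂ} (hw : ‖w‖ < 1) :
    C (kernel w) = ((Real.sqrt (1 - ‖p‖ ^ 2) : ℂ) / (1 - w * p)) •
      kernel (conj ((p - w * conj lam) / (1 - w * p))) := by
  have hlp' : conj lam * conj p = p := by simpa using congrArg conj hlp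
  have hlt : ∀ {w : ℂ}, ‖w‖ < 1 → ‖p - w * conj lam‖ < ‖1 - w * p‖ :=
    norm_sub_mul_conj_lt hp hlam hlp
  have hne : ∀ {w : ℂ}, ‖w‖ < 1 → 1 - w * p ≠ 0 := fun hw =>
    norm_pos_iff.mp ((norm_nonneg _).trans_lt (hlt hw))
  have hu : ‖conj ((p - w * conj lam) / (1 - w * p))‖ < 1 := by
    rw [RCLike.norm_conj, norm_div, div_lt_one (norm_pos_iff.mpr (hne hw))]
    exact hlt hw
  refine ext_of_eval fun z hz => ?_
  have htau : conj (tau p lam (conj z)) = (p - z * conj lam) / (1 - z * p) := by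
    simp only [tau, map_div₀, map_mul, map_sub, map_one, conj_conj]
    congr 1
    · linear_combination hlp'
    · ring
  have htau1 : ‖tau p lam (conj z)‖ < 1 := by
    rw [← RCLike.norm_conj, htau, norm_div, div_lt_one (norm_pos_iff.mpr (hne hz))]
    exact hlt hz
  have hxi : conj (xi p (conj z)) = (Real.sqrt (1 - ‖p‖ ^ 2) : ℂ) / (1 - z * p) := by
    simp only [xi, map_div₀, map_mul, map_sub, map_one, conj_conj, conj_ofReal, mul_comm p z]
  rw [hCJ _ z hz, eval_kernel hw htau1, eval_smul _ _ hz, eval_kernel hu hz, map_mul, hxi,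
    map_inv₀, map_sub, map_mul, conj_conj, htau, conj_conj, map_one, div_eq_mul_inv,
    div_eq_mul_inv _ (1 - w * p), mul_assoc, mul_assoc, ← mul_inv, ← mul_inv]
  congr 2
  rw [← mul_div_assoc, one_sub_div (hne hz), div_mul_eq_mul_div, one_sub_div (hne hw),
    mul_div_cancel₀ _ (hne hz), mul_div_cancel₀ _ (hne hw)]
  ring

end H2

/-- A bilinear identity on the disk for a linear fractional symbol is equivalent to two
conditions on its coefficients. -/
lemma linearFractional_identity_iff {p lam a b c d : ℂ} (hp : ‖p‖ < 1) (hp0 : p ≠ 0)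
    (hlam : ‖lam‖ = 1) (hlp : lam * p = conj p) :
    (∀ w z : ℂ, ‖w‖ < 1 → ‖z‖ < 1 →
      (1 - p * conj p) * ((c * z + d) * conj (c * w + d) - (a * z + b) * conj (a * w + b)) =
        (d * (1 - z * p) - b * (p - z * conj lam)) *
            conj (d * (1 - w * p) - b * (p - w * conj lam)) -
          (a * (p - z * conj lam) - c * (1 - z * p)) *
            conj (a * (p - w * conj lam) - c * (1 - w * p))) ↔
    (b * conj b - c * conj c) * p =
        (-(conj a) * c + conj b * d - a * conj b + c * conj d) * (p * conj p) ∧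
      (a * conj a - d * conj d) * (p * conj p) =
        (conj a * c - conj b * d) * conj p - (conj a * b - conj c * d) * p := by
  have hlp' : conj lam * conj p = p := by simpa using congrArg conj hlp
  have hll : lam * conj lam = 1 := by rw [Complex.mul_conj', hlam]; norm_num
  have hp0' : conj p ≠ 0 := by simpa using hp0
  have hP : 1 - p * conj p ≠ 0 := by
    rw [Complex.mul_conj', ← Complex.ofReal_pow, ← Complex.ofReal_one, ← Complex.ofReal_sub]
    exact Complex.ofReal_ne_zero.mpr (by nlinarith [norm_nonneg p])
  constructor
  · intro h
    have h00 := h 0 0 (by simp) (by simp)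
    have h01 := h 0 (1 / 2) (by simp) (by norm_num)
    simp only [map_sub, map_add, map_mul, map_zero, map_one, conj_conj] at h00 h01
    have hconj : (a * conj a - d * conj d) * (p * conj p) =
        p * (a * conj c - b * conj d) - conj p * (a * conj b - c * conj d) := by
      apply mul_left_cancel₀ hP
      linear_combination -2 * conj p * (h01 - h00) - p * conj p * h00 +
        (-b * (conj d - conj b * conj p) - a * (conj a * conj p - conj c)) * hlp'
    have hII : (a * conj a - d * conj d) * (p * conj p) =
        (conj a * c - conj b * d) * conj p - (conj a * b - conj c * d) * p := by
      have := congrArg conj hconj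
      simp only [map_sub, map_mul, conj_conj] at this
      linear_combination this
    refine ⟨?_, hII⟩
    linear_combination p * hconj - p * h00
  · rintro ⟨hI, hII⟩ w z - -
    have hI0 : b * conj b - c * conj c + conj p * (conj a * c - conj b * d) +
        conj p * (a * conj b - c * conj d) = 0 := by
      apply mul_right_cancel₀ hp0
      linear_combination hI
    have hI0' := congrArg conj hI0
    have hII' := congrArg conj hII
    simp only [map_sub, map_add, map_mul, map_zero, conj_conj] at hI0' hII'
    have e00 : (1 - p * conj p) * (d * conj d - b * conj b) =
        (d - b * p) * (conj d - conj b * conj p) - (a * p - c) * (conj a * conj p - conj c) := by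
      linear_combination hII - hI0'
    have e10 : (1 - p * conj p) * (c * conj d - a * conj b) =
        -(d * p - b * conj lam) * (conj d - conj b * conj p) +
          (a * conj lam - c * p) * (conj a * conj p - conj c) := by
      apply mul_left_cancel₀ hp0'
      linear_combination -hII' + p * conj p * hI0 +
        (-b * (conj d - conj b * conj p) - a * (conj a * conj p - conj c)) * hlp'
    have e01 := congrArg conj e10
    have e11 : (1 - p * conj p) * (c * conj c - a * conj a) =
        (d * p - b * conj lam) * (conj d * conj p - conj b * lam) -
          (a * conj lam - c * p) * (conj a * lam - conj c * conj p) := by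
      linear_combination e00 + (d * conj b - c * conj a) * hlp +
        (b * conj d - a * conj c) * hlp' + (a * conj a - b * conj b) * hll
    simp only [map_sub, map_add, map_mul, map_neg, map_one, conj_conj] at e01 ⊢
    linear_combination e00 + z * e10 + conj w * e01 + z * conj w * e11

/-- Theorem 3.2: `W_{ψ,φ}` with `ψ = β K_{σ(0)}` is `J W_{ξ_p,τ_p}`-normal iff
`(|b|² - |c|²) p = (-conj a * c + conj b * d - a * conj b + c * conj d) |p|²` and
`(|a|² - |d|²) |p|² = (conj a * c - conj b * d) conj p - (conj a * b - conj c * d) p`. -/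
theorem stmt7 (p lam a b c d β : ℂ)
    (hp : ‖p‖ < 1) (hp0 : p ≠ 0) (hlam : ‖lam‖ = 1) (hlp : lam * p = conj p)
    (hβ : β ≠ 0)
    (φ : ℂ → ℂ) (hφ : ∀ z : ℂ, φ z = (a * z + b) / (c * z + d))
    (hdet : a * d - b * c ≠ 0)
    (hden : ∀ z : ℂ, ‖z‖ < 1 → c * z + d ≠ 0)
    (hself : ∀ z : ℂ, ‖z‖ < 1 → ‖φ z‖ < 1)
    (σ : ℂ → ℂ) (hσ : ∀ z : ℂ, σ z = (conj a * z - conj c) / (-(conj b) * z + conj d))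
    (ψ : ℂ → ℂ) (hψ : ∀ z : ℂ, ψ z = β * H2.ker (σ 0) z)
    (W : H2 →L[ℂ] H2) (hW : H2.IsWCompOp ψ φ W)
    (C : H2 → H2) (hC : H2.IsConjugation C) (hCJ : H2.IsJW p lam C) :
    H2.CNormal C W ↔
      (((‖b‖ ^ 2 - ‖c‖ ^ 2 : ℝ) : ℂ) * p
          = (-(conj a) * c + conj b * d - a * conj b + c * conj d) * ((‖p‖ ^ 2 : ℝ) : ℂ) ∧
        ((‖a‖ ^ 2 - ‖d‖ ^ 2 : ℝ) : ℂ) * ((‖p‖ ^ 2 : ℝ) : ℂ)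
          = (conj a * c - conj b * d) * conj p - (conj a * b - conj c * d) * p) := by

  have hd0 : d ≠ 0 := by simpa using hden 0 (by simp)
  have hψ' : ∀ z : ℂ, ‖z‖ < 1 → ψ z = β * d / (c * z + d) := by
    intro z hz
    have h1 := hden z hz
    have h2 : 1 - conj (σ 0) * z = (c * z + d) / d := by
      rw [hσ]
      simp only [mul_zero, zero_sub, zero_add, map_div₀, map_neg, conj_conj]
      field_simp
      ring
    rw [hψ, H2.ker, h2, inv_div, mul_div_assoc]
  have hle : ∀ z : ℂ, ‖z‖ < 1 → ‖a * z + b‖ ≤ ‖c * z + d‖ := by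
    intro z hz
    have h := hself z hz
    rw [hφ, norm_div, div_lt_one (norm_pos_iff.mpr (hden z hz))] at h
    exact h.le
  have hJ : ∀ w : ℂ, ‖w‖ < 1 → ‖p - w * conj lam‖ < ‖1 - w * p‖ := fun w hw =>
    H2.norm_sub_mul_conj_lt hp hlam hlp hw
  set s : ℂ := (Real.sqrt (1 - ‖p‖ ^ 2) : ℂ) with hs
  have hss : s * conj s = 1 - p * conj p := by
    rw [hs, conj_ofReal, ← ofReal_mul, Real.mul_self_sqrt (by nlinarith [norm_nonneg p]),
      Complex.mul_conj']
    push_cast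
    rfl
  set D : ℂ → ℂ := fun w => d * (1 - w * p) - b * (p - w * conj lam) with hD
  set E : ℂ → ℂ := fun w => a * (p - w * conj lam) - c * (1 - w * p) with hE
  have hDu : ∀ w : ℂ, ‖w‖ < 1 →
      D w = (1 - w * p) * (d - (p - w * conj lam) / (1 - w * p) * b) := by
    intro w hw
    have h1 : 1 - w * p ≠ 0 := norm_pos_iff.mp ((norm_nonneg _).trans_lt (hJ w hw))
    rw [mul_sub, ← mul_assoc (1 - w * p) (_ / _), mul_div_cancel₀ _ h1]
    ring
  have hED : ∀ w : ℂ, ‖w‖ < 1 → ‖E w‖ < ‖D w‖ := by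
    intro w hw
    have h1 : 1 - w * p ≠ 0 := norm_pos_iff.mp ((norm_nonneg _).trans_lt (hJ w hw))
    have hu : ‖(p - w * conj lam) / (1 - w * p)‖ < 1 := by
      rw [norm_div, div_lt_one (norm_pos_iff.mpr h1)]
      exact hJ w hw
    have h2 := mul_lt_mul_of_pos_left (H2.norm_krein_lt hdet hle hu) (norm_pos_iff.mpr h1)
    rw [← norm_mul, ← norm_mul] at h2
    have hEw : E w = (1 - w * p) * ((p - w * conj lam) / (1 - w * p) * a - c) := by
      rw [mul_sub, ← mul_assoc, mul_div_cancel₀ _ h1]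
      ring
    rwa [hEw, hDu w hw]
  have hD0 : ∀ w : ℂ, ‖w‖ < 1 → D w ≠ 0 := fun w hw =>
    norm_pos_iff.mp ((norm_nonneg _).trans_lt (hED w hw))
  have hv : ∀ w : ℂ, ‖w‖ < 1 → ‖conj (E w / D w)‖ < 1 := by
    intro w hw
    rw [RCLike.norm_conj, norm_div, div_lt_one (norm_pos_iff.mpr (hD0 w hw))]
    exact hED w hw
  have hWC : ∀ w : ℂ, ‖w‖ < 1 →
      W (C (H2.kernel w)) = (s * (β * d) / D w) • H2.kernel (conj (E w / D w)) := by
    intro w hw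
    have h1 : 1 - w * p ≠ 0 := norm_pos_iff.mp ((norm_nonneg _).trans_lt (hJ w hw))
    have hu : ‖conj ((p - w * conj lam) / (1 - w * p))‖ < 1 := by
      rw [RCLike.norm_conj, norm_div, div_lt_one (norm_pos_iff.mpr h1)]
      exact hJ w hw
    refine H2.ext_of_eval fun z hz => ?_
    rw [hCJ.apply_kernel hp hlam hlp hw, ← hs, hW _ z hz, H2.eval_smul _ _ (hself z hz),
      H2.eval_kernel hu (hself z hz), H2.eval_smul _ _ hz, H2.eval_kernel (hv w hw) hz,
      hψ' z hz, hφ, conj_conj, conj_conj]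
    have h2 := hden z hz
    have h3 := hD0 w hw
    have h4 : D w - E w * z =
        (1 - w * p) * (c * z + d) - (p - w * conj lam) * (a * z + b) := by
      simp only [hD, hE]
      ring
    rw [div_mul_eq_mul_div (E w), one_sub_div h3, inv_div, div_mul_div_comm _ (1 - w * p),
      one_sub_div (mul_ne_zero h1 h2), inv_div, h4, div_mul_div_cancel₀ h3]
    field_simp
  have hone : ∀ x y : ℂ, ‖x‖ < 1 → ‖y‖ < 1 → 1 - x * y ≠ 0 := by
    intro x y hx hy h
    have : ‖x * y‖ = 1 := by rw [← sub_eq_zero.mp h, norm_one]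
    rw [norm_mul] at this
    nlinarith [norm_nonneg x, norm_nonneg y]
  rw [H2.cNormal_iff_inner hC]
  have hiff := linearFractional_identity_iff (a := a) (b := b) (c := c) (d := d) hp hp0 hlam hlp
  push_cast
  simp only [← Complex.mul_conj']
  rw [← hiff]
  refine forall₄_congr fun w z hw hz => ?_
  have hDw := hD0 w hw
  have hDz := hD0 z hz
  have hqw := hden w hw
  have hqz := hden z hz
  have hDw' : conj (D w) ≠ 0 := (map_ne_zero _).mpr hDw
  have hqw' : conj (c * w + d) ≠ 0 := (map_ne_zero _).mpr hqw
  have hM : D z * conj (D w) - E z * conj (E w) ≠ 0 := by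
    have h := hone _ _ (hv w hw) ((RCLike.norm_conj (E z / D z)).symm.trans_lt (hv z hz))
    intro h0
    apply h
    rw [map_div₀]
    field_simp
    linear_combination h0
  have hN : (c * z + d) * conj (c * w + d) - (a * z + b) * conj (a * w + b) ≠ 0 := by
    have h := hone _ _ ((RCLike.norm_conj (φ w)).trans_lt (hself w hw)) (hself z hz)
    intro h0
    apply h
    rw [hφ, hφ, map_div₀, div_mul_div_comm, one_sub_div (mul_ne_zero hqw' hqz),
      div_eq_zero_iff]
    left
    linear_combination h0
  have hk : (β * d) * conj (β * d) ≠ 0 := by simp [hβ, hd0]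
  have hleft : ⟪W (C (H2.kernel w)), W (C (H2.kernel z))⟫_ℂ =
      (1 - p * conj p) * ((β * d) * conj (β * d)) / (D z * conj (D w) - E z * conj (E w)) := by
    rw [hWC w hw, hWC z hz, inner_smul_left, inner_smul_right,
      ← H2.eval_eq_inner _ (hv w hw), H2.eval_kernel (hv z hz) (hv w hw), conj_conj,
      map_div₀, map_div₀, map_mul conj s, ← hss, div_mul_div_comm, one_sub_div (by positivity),
      inv_div]
    field_simp
  have hright : H2.eval (W (ContinuousLinearMap.adjoint W (H2.kernel w))) z =
      ((β * d) * conj (β * d)) /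
        ((c * z + d) * conj (c * w + d) - (a * z + b) * conj (a * w + b)) := by
    rw [hW _ z hz, hW.adjoint_kernel hw (hself w hw), H2.eval_smul _ _ (hself z hz),
      H2.eval_kernel (hself w hw) (hself z hz), hψ' z hz, hψ' w hw, hφ, hφ, map_div₀, map_div₀,
      div_mul_div_comm, one_sub_div (mul_ne_zero hqw' hqz), inv_div]
    field_simp
  rw [hleft, hright, div_eq_div_iff hM hN]
  constructor
  · intro h
    apply mul_left_cancel₀ hk
    linear_combination h
  · intro h
    linear_combination (β * d) * conj (β * d) * h
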